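/- Jordan–Kronecker decomposition theorem: Let A, B ∈ Mat_n(ℂ) be skew-symmetric matrices (Aᵀ = −A, Bᵀ = −B). Then there exists an invertible matrix P ∈ GL_n(ℂ) such that PᵀAP and PᵀBP are block-diagonal with the same partition of the index set into consecutive blocks, and each pair of corresponding diagonal blocks (A_i, B_i) is of one of the following three types: (i) a Jordan pair of size 2m with eigenvalue λ ∈ ℂ: A_i = [[0, J_m(λ)], [−J_m(λ)ᵀ, 0]] and B_i = [[0, −I_m], [I_m, 0]]; (ii) a Jordan pair of size 2m with eigenvalue ∞: A_i = [[0, −I_m], [I_m, 0]] and B_i = [[0, J_m(0)], [−J_m(0)ᵀ, 0]]; (iii) a Kronecker pair of odd size 2m−1: A_i = [[0, K], [−Kᵀ, 0]] and B_i = [[0, K′], [−K′ᵀ, 0]], where K = (I_{m−1} | 0) and K′ = (0 | I_{m−1}) are the (m−1)×m matrices obtained from I_{m−1} by appending a zero column on the right, respectively on the left (for m = 1 this is the pair of 1×1 zero blocks). -/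

import Mathlib

open Matrix

/-- The upper-triangular `m × m` Jordan block `J_m(λ)`, with `λ` on the diagonal
and `1` on the superdiagonal. -/
def jordanBlockMat (m : ℕ) (lam : ℂ) : Matrix (Fin m) (Fin m) ℂ :=
  Matrix.of fun i j => if (j : ℕ) = (i : ℕ) then lam else if (j : ℕ) = (i : ℕ) + 1 then 1 else 0

/-- `K = (I_p | 0)`: the `p × (p+1)` matrix obtained from the identity matrix `I_p`
by appending a zero column on the right. -/
def kroneckerK (p : ℕ) : Matrix (Fin p) (Fin (p + 1)) ℂ :=
  Matrix.of fun i j => if (j : ℕ) = (i : ℕ) then 1 else 0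

/-- `K' = (0 | I_p)`: the `p × (p+1)` matrix obtained from the identity matrix `I_p`
by appending a zero column on the left. -/
def kroneckerK' (p : ℕ) : Matrix (Fin p) (Fin (p + 1)) ℂ :=
  Matrix.of fun i j => if (j : ℕ) = (i : ℕ) + 1 then 1 else 0

/-- The three types of blocks occurring in the Jordan–Kronecker decomposition:
a Jordan pair of size `2(m+1)` with finite eigenvalue `lam`; a Jordan pair of size `2(m+1)`
with eigenvalue `∞`; and a Kronecker pair of odd size `2p + 1` (for `p = 0` this is the
pair of `1 × 1` zero blocks). -/
inductive JKBlockSpec : Type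
  | jordan (m : ℕ) (lam : ℂ) : JKBlockSpec
  | jordanInf (m : ℕ) : JKBlockSpec
  | kronecker (p : ℕ) : JKBlockSpec

/-- The size of a canonical block. -/
def JKBlockSpec.size : JKBlockSpec → ℕ
  | .jordan m _ => (m + 1) + (m + 1)
  | .jordanInf m => (m + 1) + (m + 1)
  | .kronecker p => p + (p + 1)

/-- The `A`-member of the canonical pair of blocks. -/
noncomputable def JKBlockSpec.blockA : (s : JKBlockSpec) → Matrix (Fin s.size) (Fin s.size) ℂ
  | .jordan m lam =>
      (Matrix.fromBlocks 0 (jordanBlockMat (m + 1) lam) (-(jordanBlockMat (m + 1) lam)ᵀ)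
        0).submatrix finSumFinEquiv.symm finSumFinEquiv.symm
  | .jordanInf m =>
      (Matrix.fromBlocks 0 (-1) 1 0 :
          Matrix (Fin (m + 1) ⊕ Fin (m + 1)) (Fin (m + 1) ⊕ Fin (m + 1)) ℂ).submatrix
        finSumFinEquiv.symm finSumFinEquiv.symm
  | .kronecker p =>
      (Matrix.fromBlocks 0 (kroneckerK p) (-(kroneckerK p)ᵀ) 0).submatrix
        finSumFinEquiv.symm finSumFinEquiv.symm

/-- The `B`-member of the canonical pair of blocks. -/
noncomputable def JKBlockSpec.blockB : (s : JKBlockSpec) → Matrix (Fin s.size) (Fin s.size) ℂ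
  | .jordan m _ =>
      (Matrix.fromBlocks 0 (-1) 1 0 :
          Matrix (Fin (m + 1) ⊕ Fin (m + 1)) (Fin (m + 1) ⊕ Fin (m + 1)) ℂ).submatrix
        finSumFinEquiv.symm finSumFinEquiv.symm
  | .jordanInf m =>
      (Matrix.fromBlocks 0 (jordanBlockMat (m + 1) 0) (-(jordanBlockMat (m + 1) 0)ᵀ)
        0).submatrix finSumFinEquiv.symm finSumFinEquiv.symm
  | .kronecker p =>
      (Matrix.fromBlocks 0 (kroneckerK' p) (-(kroneckerK' p)ᵀ) 0).submatrix
        finSumFinEquiv.symm finSumFinEquiv.symm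


/-! ### Abstract setting: a pair of skew bilinear forms -/

/-- A family `u` with prescribed Gram matrices, and a dual family of functionals whose common
kernel is orthogonal to `u` for both forms. -/
def JKBlk {V : Type} [AddCommGroup V] [Module ℂ V] (a b : V →ₗ[ℂ] V →ₗ[ℂ] ℂ)
    {κ : Type} (MA MB : Matrix κ κ ℂ) : Prop :=
  ∃ (u : κ → V) (ψ : κ → V →ₗ[ℂ] ℂ),
    (∀ i j, a (u i) (u j) = MA i j) ∧ (∀ i j, b (u i) (u j) = MB i j) ∧
    (∀ i, ψ i (u i) = 1) ∧ (∀ i j, i ≠ j → ψ i (u j) = 0) ∧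
    ∀ w, (∀ i, ψ i w = 0) → ∀ i, a (u i) w = 0 ∧ b (u i) w = 0

theorem JKBlk.reindex {V : Type} [AddCommGroup V] [Module ℂ V] {a b : V →ₗ[ℂ] V →ₗ[ℂ] ℂ}
    {κ κ' : Type} {MA MB : Matrix κ κ ℂ} (e : κ ≃ κ') (h : JKBlk a b MA MB) :
    JKBlk a b (MA.submatrix e.symm e.symm) (MB.submatrix e.symm e.symm) := by
  obtain ⟨u, ψ, h1, h2, h3, h4, h5⟩ := h
  refine ⟨fun i => u (e.symm i), fun i => ψ (e.symm i), fun i j => h1 _ _, fun i j => h2 _ _,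
    fun i => h3 _, fun i j hij => h4 _ _ (fun h => hij (e.symm.injective h)), ?_⟩
  intro w hw i
  exact h5 w (fun k => by simpa using hw (e k)) _

/-- Chains: polynomial kernel vectors of the pencil `b - t a`. -/
def JKChain {V : Type} [AddCommGroup V] [Module ℂ V] (a b : V →ₗ[ℂ] V →ₗ[ℂ] ℂ) (p : ℕ)
    (f : ℕ → V) : Prop :=
  (∃ i, f i ≠ 0) ∧ (∀ i, p < i → f i = 0) ∧ b (f 0) = 0 ∧ ∀ i, b (f (i + 1)) = a (f i)

section chains

variable {V : Type} [AddCommGroup V] [Module ℂ V] {a b : V →ₗ[ℂ] V →ₗ[ℂ] ℂ}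

theorem jk_skew_self {a : V →ₗ[ℂ] V →ₗ[ℂ] ℂ} (ha : ∀ x y, a x y = -a y x) (x : V) :
    a x x = 0 := by
  have := ha x x
  linear_combination this / 2

/-- Existence of a chain if the whole pencil is degenerate. -/
theorem jk_exists_chain [FiniteDimensional ℂ V]
    (ha : ∀ x y, a x y = -a y x) (hb : ∀ x y, b x y = -b y x)
    (h : ∀ t : ℂ, ∃ x, x ≠ 0 ∧ (b - t • a) x = 0) : ∃ p f, JKChain a b p f := by
  classical
  let β := Module.finBasis ℂ V
  let M : Matrix (Fin (Module.finrank ℂ V)) (Fin (Module.finrank ℂ V)) (Polynomial ℂ) :=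
    Matrix.of fun k j => Polynomial.C (b (β k) (β j)) - Polynomial.X * Polynomial.C (a (β k) (β j))
  have hdet : M.det = 0 := by
    apply Polynomial.funext
    intro t
    have h1 : Polynomial.eval t M.det = (M.map (Polynomial.evalRingHom t)).det := by
      rw [← Polynomial.coe_evalRingHom, RingHom.map_det]; rfl
    rw [h1, Polynomial.eval_zero, ← Matrix.exists_mulVec_eq_zero_iff]
    obtain ⟨x, hx, hx0⟩ := h t
    refine ⟨β.repr x, ?_, ?_⟩
    · intro h0
      apply hx
      apply β.repr.injective
      ext i
      simpa using congrFun h0 i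
    · ext k
      have e1 : (b - t • a) (β k) x = 0 := by
        have : (b - t • a) x (β k) = 0 := by rw [hx0]; rfl
        simp only [LinearMap.sub_apply, LinearMap.smul_apply, smul_eq_mul] at this ⊢
        rw [hb, ha]
        linear_combination -this
      conv at e1 => lhs; rw [← β.sum_repr x]
      simp only [map_sum, map_smul] at e1
      simp only [Matrix.mulVec, dotProduct, Matrix.map_apply, M, Matrix.of_apply, Pi.zero_apply]
      rw [← e1]
      refine Finset.sum_congr rfl fun j _ => ?_
      simp
      ring
  obtain ⟨v, hv, hMv⟩ := Matrix.exists_mulVec_eq_zero_iff.mpr hdet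
  let f : ℕ → V := fun i => ∑ j, (v j).coeff i • β j
  have hf : ∀ i j, β.repr (f i) j = (v j).coeff i := by
    intro i j
    simp only [f]
    rw [β.repr_sum_self]
  refine ⟨Finset.univ.sup fun j => (v j).natDegree, f, ?_, ?_, ?_, ?_⟩
  · by_contra! hcon
    apply hv
    ext j i
    rw [← hf, hcon]; simp
  · intro i hi
    apply Finset.sum_eq_zero
    intro j _
    rw [Polynomial.coeff_eq_zero_of_natDegree_lt, zero_smul]
    exact lt_of_le_of_lt (Finset.le_sup (f := fun j => (v j).natDegree) (Finset.mem_univ j)) hi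
  · apply β.ext
    intro k
    have := congrArg (fun q => Polynomial.coeff q 0) (congrFun hMv k)
    simp only [Matrix.mulVec, dotProduct, M, Matrix.of_apply, Pi.zero_apply,
      Polynomial.finsetSum_coeff, sub_mul, Polynomial.coeff_sub, mul_assoc,
      Polynomial.coeff_C_mul, Polynomial.coeff_X_mul_zero, Polynomial.coeff_zero, sub_zero] at this
    rw [hb]
    simp only [f, map_sum, map_smul, smul_eq_mul, LinearMap.zero_apply]
    rw [neg_eq_zero, ← this]
    exact Finset.sum_congr rfl fun j _ => mul_comm _ _
  · intro i
    apply β.ext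
    intro k
    have := congrArg (fun q => Polynomial.coeff q (i + 1)) (congrFun hMv k)
    simp only [Matrix.mulVec, dotProduct, M, Matrix.of_apply, Pi.zero_apply,
      Polynomial.finsetSum_coeff, sub_mul, Polynomial.coeff_sub, mul_assoc,
      Polynomial.coeff_C_mul, Polynomial.coeff_X_mul, Polynomial.coeff_zero,
      Finset.sum_sub_distrib] at this
    rw [hb, ha]
    simp only [f, map_sum, map_smul, smul_eq_mul]
    rw [neg_inj, ← sub_eq_zero, ← this]
    congr 1 <;> exact Finset.sum_congr rfl fun j _ => mul_comm _ _

/-- The dual family of a minimal chain. -/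
theorem jk_exists_dual [FiniteDimensional ℂ V]
    (ha : ∀ x y, a x y = -a y x) (hb : ∀ x y, b x y = -b y x) {p : ℕ} {f : ℕ → V}
    (hf : JKChain a b p f) (hmin : ∀ q < p, ∀ g, ¬ JKChain a b q g) :
    ∃ (e : ℕ → V) (ψ : ℕ → V →ₗ[ℂ] ℂ),
      (∀ i < p, ψ i = a (e i) ∧ ψ (i + 1) = b (e i)) ∧ ψ 0 (f 0) = 1 := by
  obtain ⟨hne, hz, h0, hs⟩ := hf
  have hf0 : f 0 ≠ 0 := by
    intro hf0
    obtain ⟨i, hi⟩ := hne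
    have hi0 : i ≠ 0 := fun h => hi (h ▸ hf0)
    have hip : i ≤ p := by
      by_contra hcon
      exact hi (hz i (by omega))
    refine hmin (p - 1) (by omega) (fun i => f (i + 1)) ⟨⟨i - 1, ?_⟩, ?_, ?_, ?_⟩
    · show f (i - 1 + 1) ≠ 0
      rwa [Nat.sub_add_cancel (by omega)]
    · intro j hj; exact hz _ (by omega)
    · simp only [hs, hf0, map_zero]
    · intro j; exact hs _
  obtain ⟨θ, hθ⟩ : ∃ θ : V →ₗ[ℂ] ℂ, θ (f 0) = 1 := by
    obtain ⟨g, hg, -⟩ := Submodule.exists_le_ker_of_notMem (K := ℂ) (p := ⊥) (v := f 0) (by simpa using hf0)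
    exact ⟨(g (f 0))⁻¹ • g, by simp [hg]⟩
  rcases p with _ | q
  · exact ⟨fun _ => 0, fun _ => θ, fun i hi => absurd hi (by omega), hθ⟩
  classical
  let Ψ : (Fin (q + 2) → V) →ₗ[ℂ] (Fin (q + 1) → (V →ₗ[ℂ] ℂ)) :=
    LinearMap.pi fun i => b ∘ₗ LinearMap.proj i.castSucc - a ∘ₗ LinearMap.proj i.succ
  have hΨ : ∀ u i, Ψ u i = b (u i.castSucc) - a (u i.succ) := fun u i => rfl
  have hmem : (Pi.single 0 (-θ) : Fin (q + 1) → (V →ₗ[ℂ] ℂ)) ∈ LinearMap.range Ψ := by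
    by_contra hcon
    obtain ⟨g, hg, hg'⟩ := Submodule.exists_le_ker_of_notMem hcon
    let w : Fin (q + 1) → V := fun i =>
      (Module.evalEquiv ℂ V).symm (g ∘ₗ LinearMap.single ℂ (fun _ => V →ₗ[ℂ] ℂ) i)
    have hw : ∀ i (φ : V →ₗ[ℂ] ℂ), φ (w i) = g (Pi.single i φ) := by
      intro i φ
      have := (Module.evalEquiv ℂ V).apply_symm_apply
        (g ∘ₗ LinearMap.single ℂ (fun _ => V →ₗ[ℂ] ℂ) i)
      have := LinearMap.congr_fun this φ
      simp [w]
    have hgs : ∀ φ, g φ = ∑ i, φ i (w i) := by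
      intro φ
      conv_lhs => rw [← Finset.univ_sum_single φ]
      rw [map_sum]
      exact Finset.sum_congr rfl fun i _ => (hw _ _).symm
    have hrel : ∀ u : Fin (q + 2) → V,
        ∑ i : Fin (q + 1), (b (u i.castSucc) (w i) - a (u i.succ) (w i)) = 0 := by
      intro u
      have := hg' (LinearMap.mem_range_self Ψ u)
      rw [LinearMap.mem_ker, hgs] at this
      exact this
    let W : ℕ → V := fun i => if h : i < q + 1 then w ⟨i, h⟩ else 0
    have hW : ∀ i : Fin (q + 1), W i = w i := by
      intro i; simp only [W]; rw [dif_pos i.2]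
    have hrel' : ∀ u : ℕ → V, ∑ i ∈ Finset.range (q + 1), (b (u i) (W i) - a (u (i + 1)) (W i)) = 0 := by
      intro u
      rw [Finset.sum_range, ← hrel (fun i => u i)]
      refine Finset.sum_congr rfl fun i _ => ?_
      rw [hW]; rfl
    refine hmin q (by omega) W ⟨?_, ?_, ?_, ?_⟩
    · by_contra! hall
      apply hg
      rw [hgs]
      apply Finset.sum_eq_zero
      intro i _
      rw [← hW, hall, map_zero]
    · intro i hi
      simp only [W]
      rw [dif_neg (by omega)]
    · ext y
      have := hrel' (fun i => if i = 0 then y else 0)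
      rw [Finset.sum_eq_single 0 (fun i _ hi => by simp [hi]) (fun h => by simp at h)] at this
      rw [hb]
      simpa using this
    · intro i
      ext y
      have := hrel' (fun j => if j = i + 1 then y else 0)
      rw [hb, ha (W i)]
      by_cases hi : i + 1 < q + 1
      · rw [Finset.sum_sub_distrib,
          Finset.sum_eq_single (i + 1) (fun j _ hi => by simp [hi]) (fun h => by simp at h; omega),
          Finset.sum_eq_single i (fun j _ hi => by simp [hi]) (fun h => by simp at h; omega)] at this
        simp only [if_true] at this
        linear_combination -this
      · have hW0 : W (i + 1) = 0 := by
          simp only [W]; rw [dif_neg hi]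
        rw [hW0, map_zero]
        by_cases hi' : i = q
        · rw [Finset.sum_sub_distrib,
            Finset.sum_eq_zero (fun j hj => by
              rw [if_neg (by simp at hj; omega)]; simp),
            Finset.sum_eq_single i (fun j _ hi => by simp [hi]) (fun h => by simp at h; omega)] at this
          simp only [if_true] at this
          linear_combination -this
        · have hW0 : W i = 0 := by
            simp only [W]; rw [dif_neg (by omega)]
          rw [hW0, map_zero]
  obtain ⟨u, hu⟩ := hmem
  let U : ℕ → V := fun i => if h : i < q + 2 then u ⟨i, h⟩ else 0
  have hU : ∀ i (hi : i < q + 1),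
      b (U i) - a (U (i + 1)) = (Pi.single 0 (-θ) : Fin (q + 1) → (V →ₗ[ℂ] ℂ)) ⟨i, hi⟩ := by
    intro i hi
    rw [← hu, hΨ]
    simp only [U]
    rw [dif_pos (by omega), dif_pos (by omega)]
    rfl
  refine ⟨fun i => U (i + 1), fun i => if i = 0 then a (U 1) else b (U i), ?_, ?_⟩
  · intro i hi
    refine ⟨?_, by simp⟩
    rcases i with _ | i
    · simp
    · have := hU (i + 1) hi
      rw [Pi.single_eq_of_ne (by simp [Fin.ext_iff])] at this
      simpa using sub_eq_zero.mp this
  · have h1 := hU 0 (by omega)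
    have h2 : b (U 0) (f 0) = 0 := by rw [hb, h0]; simp
    have h3 := LinearMap.congr_fun h1 (f 0)
    simp only [LinearMap.sub_apply, h2] at h3
    simp at h3
    simp [h3, hθ]

end chains

section blocks

variable {V : Type} [AddCommGroup V] [Module ℂ V] {a b : V →ₗ[ℂ] V →ₗ[ℂ] ℂ}

theorem jk_chain_isotropic (ha : ∀ x y, a x y = -a y x) (hb : ∀ x y, b x y = -b y x)
    {f : ℕ → V} (h0 : b (f 0) = 0) (hs : ∀ i, b (f (i + 1)) = a (f i)) :
    (∀ i j, a (f i) (f j) = 0) ∧ (∀ i j, b (f i) (f j) = 0) := by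
  have h1 : ∀ j i, a (f i) (f j) = 0 := by
    intro j
    induction j with
    | zero => intro i; rw [← hs, hb, h0]; simp
    | succ j ih => intro i; rw [← hs, hb, hs, ha, ih, neg_zero, neg_zero]
  refine ⟨fun i j => h1 j i, fun i j => ?_⟩
  rcases i with _ | i
  · rw [h0]; simp
  · rw [hs, h1]

theorem jk_dual_isotropic (ha : ∀ x y, a x y = -a y x) (hb : ∀ x y, b x y = -b y x)
    {p : ℕ} {e : ℕ → V} {ψ : ℕ → V →ₗ[ℂ] ℂ}
    (h : ∀ i < p, ψ i = a (e i) ∧ ψ (i + 1) = b (e i)) :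
    ∀ i j, i ≤ p → j < p → ψ i (e j) = 0 := by
  have key : ∀ d i j, i ≤ p → j < p → i = j + d → ψ i (e j) = 0 := by
    intro d
    induction d using Nat.strong_induction_on with
    | _ d ih =>
      intro i j hi hj hd
      rcases d with _ | _ | d
      · obtain rfl : i = j := by omega
        rw [(h i hj).1, jk_skew_self ha]
      · obtain rfl : i = j + 1 := by omega
        rw [(h j hj).2, jk_skew_self hb]
      · obtain ⟨i, rfl⟩ : ∃ k, i = k + 1 := ⟨i - 1, by omega⟩
        rw [(h i (by omega)).2, hb, ← (h j hj).2, (h (j + 1) (by omega)).1, ha, neg_neg,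
          ← (h i (by omega)).1]
        exact ih d (by omega) i (j + 1) (by omega) (by omega) (by omega)
  intro i j hi hj
  rcases le_or_gt j i with hij | hij
  · exact key (i - j) i j hi hj (by omega)
  · rw [(h i (by omega)).1, ha, ← (h j hj).1, key (j - i) j i (by omega) (by omega) (by omega),
      neg_zero]

theorem jk_kronecker_block [FiniteDimensional ℂ V]
    (ha : ∀ x y, a x y = -a y x) (hb : ∀ x y, b x y = -b y x)
    (hex : ∃ p f, JKChain a b p f) :
    ∃ s : JKBlockSpec, JKBlk a b s.blockA s.blockB := by
  classical
  obtain ⟨p, ⟨f, hf⟩, hmin⟩ : ∃ p, (∃ f, JKChain a b p f) ∧ ∀ q < p, ∀ g, ¬ JKChain a b q g :=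
    ⟨Nat.find hex, Nat.find_spec hex, fun q hq g hg => Nat.find_min hex hq ⟨g, hg⟩⟩
  obtain ⟨e, ψ, h, hψ0⟩ := jk_exists_dual ha hb hf hmin
  obtain ⟨-, hz, h0, hs⟩ := hf
  obtain ⟨iaf, ibf⟩ := jk_chain_isotropic ha hb h0 hs
  have ie := jk_dual_isotropic ha hb h
  have st : ∀ i < p, ∀ j, ψ (i + 1) (f (j + 1)) = ψ i (f j) := by
    intro i hi j
    rw [(h i hi).2, (h i hi).1, hb, hs, ha (e i)]
  have st0 : ∀ i < p, ψ (i + 1) (f 0) = 0 := by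
    intro i hi
    rw [(h i hi).2, hb, h0]; simp
  have stn : ∀ i ≤ p, ∀ j, ψ i (f (j + i)) = ψ 0 (f j) := by
    intro i
    induction i with
    | zero => intro _ j; rfl
    | succ i ih =>
      intro hi j
      rw [← add_assoc, st i (by omega), ih (by omega)]
  have hψ : ∀ i ≤ p, ∀ j, ψ i (f j) = if j = i then 1 else 0 := by
    intro i hi j
    rcases lt_trichotomy j i with hij | rfl | hij
    · rw [if_neg (by omega)]
      induction i generalizing j with
      | zero => omega
      | succ i ih =>
        rcases j with _ | j
        · exact st0 i (by omega)
        · rw [st i (by omega)]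
          exact ih (by omega) j (by omega)
    · have := stn j hi 0
      rw [if_pos rfl, ← hψ0, ← this, zero_add]
    · rw [if_neg (by omega)]
      obtain ⟨k, rfl⟩ : ∃ k, j = k + i := ⟨j - i, by omega⟩
      rw [stn i hi, ← stn p le_rfl, hz _ (by omega), map_zero]
  have aef : ∀ i < p, ∀ j, a (e i) (f j) = if j = i then 1 else 0 := by
    intro i hi j
    rw [← (h i hi).1, hψ i hi.le]
  have bef : ∀ i < p, ∀ j, b (e i) (f j) = if j = i + 1 then 1 else 0 := by
    intro i hi j
    rw [← (h i hi).2, hψ (i + 1) hi]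
  have aee : ∀ i < p, ∀ j < p, a (e i) (e j) = 0 := by
    intro i hi j hj
    rw [← (h i hi).1, ie i j hi.le hj]
  have bee : ∀ i < p, ∀ j < p, b (e i) (e j) = 0 := by
    intro i hi j hj
    rw [← (h i hi).2, ie (i + 1) j hi hj]
  refine ⟨.kronecker p, JKBlk.reindex (finSumFinEquiv (m := p) (n := p + 1))
    (MA := Matrix.fromBlocks 0 (kroneckerK p) (-(kroneckerK p)ᵀ) 0)
    (MB := Matrix.fromBlocks 0 (kroneckerK' p) (-(kroneckerK' p)ᵀ) 0)
    ⟨Sum.elim (fun i => e i) (fun j => f j), Sum.elim (fun i => - a (f i)) (fun j => ψ j),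
      ?_, ?_, ?_, ?_, ?_⟩⟩
  · rintro (i | i) (j | j)
    · simpa using aee i i.2 j j.2
    · simpa [kroneckerK] using aef i i.2 j
    · simp only [Sum.elim_inl, Sum.elim_inr]
      rw [ha, aef j j.2 i]
      simp [kroneckerK]
    · simpa using iaf i j
  · rintro (i | i) (j | j)
    · simpa using bee i i.2 j j.2
    · simpa [kroneckerK'] using bef i i.2 j
    · simp only [Sum.elim_inl, Sum.elim_inr]
      rw [hb, bef j j.2 i]
      simp [kroneckerK']
    · simpa using ibf i j
  · rintro (i | i)
    · simp only [Sum.elim_inl, LinearMap.neg_apply]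
      rw [ha, aef i i.2, if_pos rfl, neg_neg]
    · simp only [Sum.elim_inr]
      rw [hψ i (by omega), if_pos rfl]
  · rintro (i | i) (j | j) hij
    · simp only [Sum.elim_inl, LinearMap.neg_apply]
      rw [ha, aef j j.2, if_neg (fun h => hij (by rw [Fin.ext h])), neg_neg]
    · simp [iaf]
    · simp only [Sum.elim_inl, Sum.elim_inr]
      exact ie i j (by omega) j.2
    · simp only [Sum.elim_inr]
      rw [hψ i (by omega), if_neg (fun h => hij (by rw [Fin.ext h]))]
  · intro w hw
    have hwf : ∀ i < p, a (f i) w = 0 := fun i hi => by simpa using hw (Sum.inl ⟨i, hi⟩)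
    have hwψ : ∀ i ≤ p, ψ i w = 0 := fun i hi => hw (Sum.inr ⟨i, by omega⟩)
    rintro (i | i)
    · simp only [Sum.elim_inl]
      rw [← (h i i.2).1, ← (h i i.2).2]
      exact ⟨hwψ _ i.2.le, hwψ _ i.2⟩
    · simp only [Sum.elim_inr]
      obtain ⟨i, hi⟩ := i
      simp only
      constructor
      · rcases Nat.lt_or_ge i p with hip | hip
        · exact hwf i hip
        · rw [← hs, hz _ (by omega)]; simp
      · rcases i with _ | i
        · rw [h0]; simp
        · rw [hs]; exact hwf i (by omega)

/-- The nilpotent case: `a(x,y) = -b(N x, y)`, with `N` nilpotent and `b` nondegenerate. -/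
theorem jk_nil_block [FiniteDimensional ℂ V] [Nontrivial V]
    (ha : ∀ x y, a x y = -a y x) (hb : ∀ x y, b x y = -b y x) (hinj : Function.Injective b)
    (N : Module.End ℂ V) (hN : IsNilpotent N) (hab : ∀ x y, a x y = -b (N x) y) :
    ∃ m, JKBlk a b
      (Matrix.fromBlocks 0 (jordanBlockMat (m + 1) 0) (-(jordanBlockMat (m + 1) 0)ᵀ) 0)
      (Matrix.fromBlocks 0 (-1) 1 0 :
          Matrix (Fin (m + 1) ⊕ Fin (m + 1)) (Fin (m + 1) ⊕ Fin (m + 1)) ℂ) := by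
  classical
  obtain ⟨m, hm0, hm1⟩ : ∃ m, N ^ m ≠ 0 ∧ N ^ (m + 1) = 0 := by
    have h1 := pow_nilpotencyClass hN
    have h2 := pos_nilpotencyClass_iff.mpr hN
    obtain ⟨m, hm⟩ : ∃ m, nilpotencyClass N = m + 1 := ⟨nilpotencyClass N - 1, by omega⟩
    have h3 := pow_pred_nilpotencyClass hN
    rw [hm] at h1 h3
    exact ⟨m, h3, h1⟩
  have hz : ∀ k, m < k → ∀ x, (N ^ k) x = 0 := by
    intro k hk x
    rw [pow_eq_zero_of_le hk hm1]; rfl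
  have adj : ∀ x y, b (N x) y = b x (N y) := by
    intro x y
    have h1 := hab x y
    have h2 := hab y x
    rw [hb x (N y)]
    linear_combination h1 + h2 - ha x y
  have adjp : ∀ k x y, b ((N ^ k) x) y = b x ((N ^ k) y) := by
    intro k
    induction k with
    | zero => intro x y; rfl
    | succ k ih =>
      intro x y
      rw [pow_succ', Module.End.mul_apply, adj, ih, ← Module.End.mul_apply, ← pow_succ, pow_succ']
  have iso : ∀ k x, b ((N ^ k) x) x = 0 := by
    intro k x
    have h1 := adjp k x x
    rw [hb x] at h1
    linear_combination h1 / 2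
  obtain ⟨x, hx⟩ : ∃ x, (N ^ m) x ≠ 0 := by
    by_contra! hcon
    exact hm0 (LinearMap.ext hcon)
  obtain ⟨y, hy⟩ : ∃ y, ∀ i ≤ m, b ((N ^ i) x) y = if i = m then -1 else 0 := by
    have hstep : ∀ k ≤ m, ∃ y, b ((N ^ m) x) y = -1 ∧
        ∀ i, m - k ≤ i → i < m → b ((N ^ i) x) y = 0 := by
      intro k
      induction k with
      | zero =>
        intro _
        obtain ⟨y, hy⟩ : ∃ y, b ((N ^ m) x) y ≠ 0 := by
          by_contra! hcon
          exact hx (hinj (by rw [map_zero]; exact LinearMap.ext hcon))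
        refine ⟨-(b ((N ^ m) x) y)⁻¹ • y, by simp [hy], fun i h1 h2 => by omega⟩
      | succ k ih =>
        intro hk
        obtain ⟨y, hy1, hy2⟩ := ih (by omega)
        have hsh : ∀ i, b ((N ^ i) x) ((N ^ (k + 1)) y) = b ((N ^ (k + 1 + i)) x) y := by
          intro i
          rw [← adjp, ← Module.End.mul_apply, ← pow_add]
        refine ⟨y + b ((N ^ (m - (k + 1))) x) y • (N ^ (k + 1)) y, ?_, ?_⟩
        · rw [map_add, map_smul, hsh, hz (k + 1 + m) (by omega)]
          simp [hy1]
        · intro i h1 h2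
          rw [map_add, map_smul, hsh]
          rcases Nat.eq_or_lt_of_le h1 with heq | hlt
          · rw [show k + 1 + i = m by omega, hy1, heq]
            simp
          · rw [hz (k + 1 + i) (by omega), hy2 i (by omega) h2]
            simp
    obtain ⟨y, hy1, hy2⟩ := hstep m le_rfl
    refine ⟨y, fun i hi => ?_⟩
    split_ifs with him
    · rw [him, hy1]
    · exact hy2 i (by omega) (by omega)
  have hxy : ∀ i j, j ≤ m → b ((N ^ i) x) ((N ^ (m - j)) y) = if j = i then -1 else 0 := by
    intro i j hj
    rw [← adjp, ← Module.End.mul_apply, ← pow_add]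
    rcases Nat.lt_or_ge m (m - j + i) with hlt | hge
    · rw [hz _ hlt, if_neg (by omega)]; simp
    · rw [hy _ hge]
      congr 1
      simp only [eq_iff_iff]; omega
  have hxx : ∀ i j, b ((N ^ i) x) ((N ^ j) x) = 0 := by
    intro i j
    rw [← adjp, ← Module.End.mul_apply, ← pow_add, iso]
  have hyy : ∀ i j, b ((N ^ i) y) ((N ^ j) y) = 0 := by
    intro i j
    rw [← adjp, ← Module.End.mul_apply, ← pow_add, iso]
  have hsucc : ∀ k (z : V), N ((N ^ k) z) = (N ^ (k + 1)) z := by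
    intro k z; rw [pow_succ', Module.End.mul_apply]
  have hyx : ∀ i j, j ≤ m → b ((N ^ (m - j)) y) ((N ^ i) x) = if j = i then 1 else 0 := by
    intro i j hj
    rw [hb, hxy i j hj]; split_ifs <;> simp
  refine ⟨m, Sum.elim (fun i => (N ^ (i : ℕ)) x) (fun j => (N ^ (m - (j : ℕ))) y),
    Sum.elim (fun i => b ((N ^ (m - (i : ℕ))) y)) (fun j => - b ((N ^ (j : ℕ)) x)),
    ?_, ?_, ?_, ?_, ?_⟩
  · rintro (i | i) (j | j)
    · simp [hab, hsucc, hxx]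
    · simp only [Sum.elim_inl, Sum.elim_inr, hab, hsucc]
      rw [hxy _ _ (by omega)]
      simp only [jordanBlockMat, Matrix.fromBlocks_apply₁₂, Matrix.of_apply]
      split_ifs <;> simp <;> omega
    · simp only [Sum.elim_inl, Sum.elim_inr]
      rw [ha, hab, hsucc, hxy _ _ (by omega)]
      simp only [jordanBlockMat, Matrix.fromBlocks_apply₂₁, Matrix.of_apply, Matrix.neg_apply,
        Matrix.transpose_apply]
      split_ifs <;> simp <;> omega
    · simp [hab, hsucc, hyy]
  · rintro (i | i) (j | j)
    · simp [hxx]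
    · simp only [Sum.elim_inl, Sum.elim_inr]
      rw [hxy _ _ (by omega)]
      simp only [Matrix.fromBlocks_apply₁₂, Matrix.neg_apply, Matrix.one_apply, Fin.ext_iff]
      split_ifs <;> simp <;> omega
    · simp only [Sum.elim_inl, Sum.elim_inr]
      rw [hyx _ _ (by omega)]
      simp only [Matrix.fromBlocks_apply₂₁, Matrix.one_apply, Fin.ext_iff]
    · simp [hyy]
  · rintro (i | i)
    · simp only [Sum.elim_inl]
      rw [hyx _ _ (by omega), if_pos rfl]
    · simp only [Sum.elim_inr, LinearMap.neg_apply]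
      rw [hxy _ _ (by omega), if_pos rfl, neg_neg]
  · rintro (i | i) (j | j) hij
    · simp only [Sum.elim_inl]
      rw [hyx _ _ (by omega), if_neg (fun h => hij (by rw [Fin.ext h]))]
    · simp [hyy]
    · simp [hxx]
    · simp only [Sum.elim_inr, LinearMap.neg_apply]
      rw [hxy _ _ (by omega), if_neg (fun h => hij (by rw [Fin.ext h])), neg_zero]
  · intro w hw
    have hwx : ∀ i, b ((N ^ i) x) w = 0 := by
      intro i
      rcases Nat.lt_or_ge m i with hlt | hge
      · rw [hz _ hlt]; simp
      · simpa using hw (Sum.inr ⟨i, by omega⟩)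
    have hwy : ∀ i, b ((N ^ i) y) w = 0 := by
      intro i
      rcases Nat.lt_or_ge m i with hlt | hge
      · rw [hz _ hlt]; simp
      · have := hw (Sum.inl ⟨m - i, by omega⟩)
        simp only [Sum.elim_inl] at this
        rwa [show m - (m - i) = i by omega] at this
    rintro (i | i)
    · simp [hab, hsucc, hwx]
    · simp [hab, hsucc, hwy]

end blocks

section decomposition

/-- A basis of `V` in which both forms are block diagonal with canonical blocks. -/
def JKDec {V : Type} [AddCommGroup V] [Module ℂ V] (a b : V →ₗ[ℂ] V →ₗ[ℂ] ℂ) : Prop :=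
  ∃ (ι : Type) (_ : Fintype ι) (spec : ι → JKBlockSpec)
    (bas : Module.Basis (Σ i, Fin (spec i).size) ℂ V),
    (∀ i j j', a (bas ⟨i, j⟩) (bas ⟨i, j'⟩) = (spec i).blockA j j' ∧
      b (bas ⟨i, j⟩) (bas ⟨i, j'⟩) = (spec i).blockB j j') ∧
    ∀ i i' j j', i ≠ i' → a (bas ⟨i, j⟩) (bas ⟨i', j'⟩) = 0 ∧ b (bas ⟨i, j⟩) (bas ⟨i', j'⟩) = 0

variable {V : Type} [AddCommGroup V] [Module ℂ V] {a b : V →ₗ[ℂ] V →ₗ[ℂ] ℂ}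

theorem JKDec.combine (ha : ∀ x y, a x y = -a y x) (hb : ∀ x y, b x y = -b y x)
    {U W : Submodule ℂ V} (hc : IsCompl U W)
    (hort : ∀ u ∈ U, ∀ w ∈ W, a u w = 0 ∧ b u w = 0)
    (hU : JKDec (a.domRestrict₁₂ U U) (b.domRestrict₁₂ U U))
    (hW : JKDec (a.domRestrict₁₂ W W) (b.domRestrict₁₂ W W)) : JKDec a b := by
  obtain ⟨ι, _, s, β, h1, h2⟩ := hU
  obtain ⟨ι', _, s', β', h1', h2'⟩ := hW
  let bas : Module.Basis (Σ i : ι ⊕ ι', Fin (Sum.elim s s' i).size) ℂ V :=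
    ((β.prod β').map (Submodule.prodEquivOfIsCompl U W hc)).reindex
      (Equiv.sumSigmaDistrib (fun i : ι ⊕ ι' => Fin (Sum.elim s s' i).size)).symm
  have hl : ∀ i (j : Fin (s i).size), bas ⟨Sum.inl i, j⟩ = (β ⟨i, j⟩ : V) := by
    intro i j
    simp [bas, Module.Basis.reindex_apply, Equiv.sumSigmaDistrib]
  have hr : ∀ i (j : Fin (s' i).size), bas ⟨Sum.inr i, j⟩ = (β' ⟨i, j⟩ : V) := by
    intro i j
    simp [bas, Module.Basis.reindex_apply, Equiv.sumSigmaDistrib]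
  refine ⟨ι ⊕ ι', inferInstance, Sum.elim s s', bas, ?_, ?_⟩
  · rintro (i | i) j j'
    · rw [hl i j, hl i j']; exact h1 i j j'
    · rw [hr i j, hr i j']; exact h1' i j j'
  · rintro (i | i) (i' | i') j j' hne
    · rw [hl i j, hl i' j']; exact h2 i i' j j' (fun h => hne (by rw [h]))
    · rw [hl i j, hr i' j']; exact hort _ (β _).2 _ (β' _).2
    · rw [hr i j, hl i' j', ha, hb, (hort _ (β _).2 _ (β' _).2).1, (hort _ (β _).2 _ (β' _).2).2]
      simp
    · rw [hr i j, hr i' j']; exact h2' i i' j j' (fun h => hne (by rw [h]))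

theorem JKBlockSpec.size_pos (s : JKBlockSpec) : 0 < s.size := by
  cases s <;> simp [JKBlockSpec.size]

theorem JKDec.of_block [FiniteDimensional ℂ V]
    (ha : ∀ x y, a x y = -a y x) (hb : ∀ x y, b x y = -b y x)
    {s : JKBlockSpec} (hs : JKBlk a b s.blockA s.blockB)
    (ih : ∀ W : Submodule ℂ V, Module.finrank ℂ W < Module.finrank ℂ V →
      JKDec (a.domRestrict₁₂ W W) (b.domRestrict₁₂ W W)) : JKDec a b := by
  obtain ⟨u, ψ, h1, h2, h3, h4, h5⟩ := hs
  have hψ : ∀ (c : Fin s.size → ℂ) i, ψ i (∑ j, c j • u j) = c i := by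
    intro c i
    rw [map_sum, Finset.sum_eq_single i]
    · simp [h3]
    · intro j _ hj; simp [h4 i j (Ne.symm hj)]
    · simp
  have hli : LinearIndependent ℂ u := by
    rw [Fintype.linearIndependent_iff]
    intro c hc i
    rw [← hψ c i, hc, map_zero]
  let U : Submodule ℂ V := Submodule.span ℂ (Set.range u)
  let W : Submodule ℂ V := ⨅ i, LinearMap.ker (ψ i)
  have hWm : ∀ w, w ∈ W ↔ ∀ i, ψ i w = 0 := by
    intro w; simp [W, Submodule.mem_iInf]
  have hc : IsCompl U W := by
    constructor
    · rw [Submodule.disjoint_def]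
      intro x hx hxW
      obtain ⟨c, rfl⟩ := (Submodule.mem_span_range_iff_exists_fun ℂ).mp hx
      apply Finset.sum_eq_zero
      intro i _
      rw [← hψ c i, (hWm _).mp hxW i, zero_smul]
    · rw [codisjoint_iff, eq_top_iff]
      intro x _
      rw [Submodule.mem_sup]
      refine ⟨∑ i, ψ i x • u i, ?_, x - ∑ i, ψ i x • u i, ?_, by abel⟩
      · exact Submodule.sum_mem _ fun i _ => Submodule.smul_mem _ _
          (Submodule.subset_span (Set.mem_range_self i))
      · rw [hWm]
        intro i
        rw [map_sub, hψ (fun i => ψ i x) i, sub_self]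
  have hort : ∀ x ∈ U, ∀ w ∈ W, a x w = 0 ∧ b x w = 0 := by
    intro x hx w hw
    obtain ⟨c, rfl⟩ := (Submodule.mem_span_range_iff_exists_fun ℂ).mp hx
    have := h5 w ((hWm w).mp hw)
    simp [map_sum, LinearMap.sum_apply, this]
  refine JKDec.combine ha hb hc hort ?_ (ih W ?_)
  · let β : Module.Basis (Σ _ : Unit, Fin s.size) ℂ U :=
      (Module.Basis.span hli).reindex (Equiv.uniqueSigma (fun _ : Unit => Fin s.size)).symm
    have hβ : ∀ i j, (β ⟨i, j⟩ : V) = u j := by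
      intro i j
      simp only [β, Module.Basis.reindex_apply, Equiv.symm_symm]
      exact congrArg Subtype.val (Module.Basis.span_apply hli j)
    refine ⟨Unit, inferInstance, fun _ => s, β, ?_, ?_⟩
    · intro i j j'
      simp only [LinearMap.domRestrict₁₂_apply, hβ]
      exact ⟨h1 _ _, h2 _ _⟩
    · intro i i' j j' hne
      exact absurd (Subsingleton.elim i i') hne
  · have e1 := Submodule.finrank_add_eq_of_isCompl hc
    have e2 : Module.finrank ℂ U = s.size := by
      simp [U, finrank_span_eq_card hli]
    have := s.size_pos
    omega

/-- Fitting-type reduction plus the nilpotent case. -/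
theorem jk_regular [FiniteDimensional ℂ V] [Nontrivial V]
    (ha : ∀ x y, a x y = -a y x) (hb : ∀ x y, b x y = -b y x)
    {t : ℂ} (ht : Function.Injective (b - t • a))
    (ih : ∀ W : Submodule ℂ V, Module.finrank ℂ W < Module.finrank ℂ V →
      JKDec (a.domRestrict₁₂ W W) (b.domRestrict₁₂ W W)) : JKDec a b := by
  classical
  set c := b - t • a with hcdef
  have hbc : ∀ x y, b x y = c x y + t * a x y := by intro x y; simp [hcdef]
  have hcs : ∀ x y, c x y = -c y x := by
    intro x y
    have := hbc x y
    have := hbc y x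
    linear_combination -hbc x y - hbc y x + hb x y - t * ha x y
  let cE : V ≃ₗ[ℂ] (V →ₗ[ℂ] ℂ) :=
    LinearMap.linearEquivOfInjective c ht (Subspace.dual_finrank_eq (K := ℂ) (V := V)).symm
  have hcE : ∀ x, cE x = c x := fun x => rfl
  let R : Module.End ℂ V := cE.symm.toLinearMap ∘ₗ a
  have hR : ∀ x y, c (R x) y = a x y := by
    intro x y
    rw [← hcE]
    simp [R]
  obtain ⟨μ, hμ⟩ := Module.End.exists_eigenvalue R
  let N : Module.End ℂ V := R - algebraMap ℂ _ μ
  have hNx : ∀ x, N x = R x - μ • x := by intro x; simp [N]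
  have hRN : R = algebraMap ℂ _ μ + N := by simp [N]
  have hcomm : Commute N R := by
    apply Commute.sub_left (Commute.refl R)
    exact Algebra.commutes μ R
  have adj : ∀ x y, c (N x) y = c x (N y) := by
    intro x y
    rw [hNx, hNx]
    simp only [map_sub, map_smul, LinearMap.sub_apply, LinearMap.smul_apply, smul_eq_mul, hR]
    rw [hcs x (R y), hR]
    linear_combination ha x y
  have adjp : ∀ k x y, c ((N ^ k) x) y = c x ((N ^ k) y) := by
    intro k
    induction k with
    | zero => intro x y; rfl
    | succ k ih =>
      intro x y
      rw [pow_succ', Module.End.mul_apply, adj, ih, ← Module.End.mul_apply, ← pow_succ, pow_succ']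
  obtain ⟨k, hkc, hk1⟩ := ((N.eventually_isCompl_ker_pow_range_pow).and
    (Filter.eventually_ge_atTop 1)).exists
  have hort : ∀ x ∈ LinearMap.ker (N ^ k), ∀ y ∈ LinearMap.range (N ^ k),
      a x y = 0 ∧ b x y = 0 := by
    rintro x hx _ ⟨y, rfl⟩
    have h1 : ∀ x ∈ LinearMap.ker (N ^ k), c x ((N ^ k) y) = 0 := by
      intro x hx
      rw [← adjp, LinearMap.mem_ker.mp hx]; simp
    have h2 : a x ((N ^ k) y) = 0 := by
      rw [← hR]
      apply h1
      rw [LinearMap.mem_ker, ← Module.End.mul_apply, (hcomm.pow_left k).eq, Module.End.mul_apply,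
        LinearMap.mem_ker.mp hx, map_zero]
    exact ⟨h2, by rw [hbc, h2, h1 x hx]; simp⟩
  have hdim := Submodule.finrank_add_eq_of_isCompl hkc
  have hker : 0 < Module.finrank ℂ (LinearMap.ker (N ^ k)) := by
    obtain ⟨v, hv⟩ := hμ.exists_hasEigenvector
    have hvk : v ∈ LinearMap.ker (N ^ k) := by
      have : N v = 0 := by rw [hNx, hv.apply_eq_smul, sub_self]
      obtain ⟨k, rfl⟩ : ∃ l, k = l + 1 := ⟨k - 1, by omega⟩
      rw [LinearMap.mem_ker, pow_succ, Module.End.mul_apply, this, map_zero]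
    have : Nontrivial (LinearMap.ker (N ^ k)) :=
      ⟨⟨v, hvk⟩, 0, fun h => hv.2 (congrArg Subtype.val h)⟩
    exact Module.finrank_pos
  rcases Nat.eq_zero_or_pos (Module.finrank ℂ (LinearMap.range (N ^ k))) with hr | hr
  swap
  · exact JKDec.combine ha hb hkc hort (ih _ (by omega)) (ih _ (by omega))
  have hnil : IsNilpotent N := by
    refine ⟨k, ?_⟩
    rw [Submodule.finrank_eq_zero, LinearMap.range_eq_bot] at hr
    exact hr
  -- a criterion for injectivity and the nilpotent operator
  have crit : ∀ (b' a' : V →ₗ[ℂ] V →ₗ[ℂ] ℂ) (r s : ℂ), r ≠ 0 →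
      (∀ x y, b' x y = -b' y x) → (∀ x y, a' x y = -a' y x) →
      (∀ x y, b' x y = r * c x y + s * c (N x) y) →
      (∃ q : ℂ, ∀ x y, a' x y = q * c (N x) y) →
      ∃ m, JKBlk a' b'
        (Matrix.fromBlocks 0 (jordanBlockMat (m + 1) 0) (-(jordanBlockMat (m + 1) 0)ᵀ) 0)
        (Matrix.fromBlocks 0 (-1) 1 0 :
          Matrix (Fin (m + 1) ⊕ Fin (m + 1)) (Fin (m + 1) ⊕ Fin (m + 1)) ℂ) := by
    rintro b' a' r s hr0 hb' ha' hbN ⟨q, haN⟩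
    have hNs : IsNilpotent (s • N) := hnil.smul s
    have hu : IsUnit (algebraMap ℂ (Module.End ℂ V) r + s • N) :=
      hNs.isUnit_add_left_of_commute ((IsUnit.mk0 r hr0).map _) (Algebra.commutes r _).symm
    obtain ⟨S, hS⟩ := hu
    have hSx : ∀ x y, b' x y = c ((S : Module.End ℂ V) x) y := by
      intro x y
      rw [hS, hbN]; simp
    have hNS : Commute N (S : Module.End ℂ V) := by
      rw [hS]
      exact Commute.add_right (Algebra.commutes r _).symm ((Commute.refl N).smul_right s)
    have hNS' : Commute N ((S⁻¹ : (Module.End ℂ V)ˣ) : Module.End ℂ V) := hNS.units_inv_right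
    refine jk_nil_block ha' hb' ?_ (-q • (((S⁻¹ : (Module.End ℂ V)ˣ) : Module.End ℂ V) * N)) ?_ ?_
    · rw [injective_iff_map_eq_zero]
      intro x hx
      have h1 : (S : Module.End ℂ V) x = 0 := by
        apply ht
        rw [map_zero]
        ext y
        rw [← hSx, hx]
      have h2 : x = ((S⁻¹ : (Module.End ℂ V)ˣ) : Module.End ℂ V) ((S : Module.End ℂ V) x) := by
        rw [← Module.End.mul_apply, Units.inv_mul]; rfl
      rw [h2, h1, map_zero]
    · exact (hNS'.symm.isNilpotent_mul_left hnil).smul _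
    · intro x y
      rw [hSx, haN, LinearMap.smul_apply, map_smul, Module.End.mul_apply, ← Module.End.mul_apply,
        Units.mul_inv]
      simp
  have haN : ∀ x y, a x y = μ * c x y + c (N x) y := by
    intro x y
    rw [hNx, ← hR]; simp
  by_cases h0 : 1 + t * μ = 0
  · have hμ0 : μ ≠ 0 := by rintro rfl; simp at h0
    obtain ⟨m, hm⟩ := crit a b μ 1 hμ0 ha hb (fun x y => by rw [haN]; ring)
      ⟨t, fun x y => by rw [hbc, haN]; linear_combination c x y * h0⟩
    refine JKDec.of_block (s := .jordanInf m) ha hb ?_ ih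
    obtain ⟨u, ψ, h1, h2, h3, h4, h5⟩ := hm
    exact JKBlk.reindex finSumFinEquiv ⟨u, ψ, h2, h1, h3, h4, fun w hw i => (h5 w hw i).symm⟩
  · set lam : ℂ := -μ / (1 + t * μ) with hlam
    have hl : μ + lam * (1 + t * μ) = 0 := by rw [hlam, div_mul_cancel₀ _ h0]; ring
    obtain ⟨m, hm⟩ := crit b (a + lam • b) (1 + t * μ) t h0 hb
      (fun x y => by
        simp only [LinearMap.add_apply, LinearMap.smul_apply, smul_eq_mul]
        linear_combination ha x y + lam * hb x y)
      (fun x y => by rw [hbc, haN]; ring)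
      ⟨1 + lam * t, fun x y => by
        simp only [LinearMap.add_apply, LinearMap.smul_apply, smul_eq_mul]
        rw [hbc, haN]; linear_combination c x y * hl⟩
    refine JKDec.of_block (s := .jordan m lam) ha hb ?_ ih
    obtain ⟨u, ψ, h1, h2, h3, h4, h5⟩ := hm
    refine JKBlk.reindex finSumFinEquiv ⟨u, ψ, ?_, h2, h3, h4, fun w hw i => ?_⟩
    · intro i j
      have e1 := h1 i j
      have e2 := h2 i j
      simp only [LinearMap.add_apply, LinearMap.smul_apply, smul_eq_mul] at e1
      rw [e2] at e1
      rw [← sub_eq_iff_eq_add.mpr e1.symm]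
      rcases i with i | i <;> rcases j with j | j
      · simp
      · simp only [Matrix.fromBlocks_apply₁₂, jordanBlockMat, Matrix.of_apply, Matrix.neg_apply,
          Matrix.one_apply, Fin.ext_iff]
        split_ifs <;> first | omega | simp
      · simp only [Matrix.fromBlocks_apply₂₁, jordanBlockMat, Matrix.of_apply, Matrix.neg_apply,
          Matrix.one_apply, Fin.ext_iff, Matrix.transpose_apply]
        split_ifs <;> first | omega | simp
      · simp
    · have := h5 w hw i
      simp only [LinearMap.add_apply, LinearMap.smul_apply, smul_eq_mul] at this
      refine ⟨?_, this.2⟩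
      linear_combination this.1 - lam * this.2

theorem jk_main (d : ℕ) : ∀ (V : Type) [AddCommGroup V] [Module ℂ V] [FiniteDimensional ℂ V]
    (a b : V →ₗ[ℂ] V →ₗ[ℂ] ℂ) (_ : ∀ x y, a x y = -a y x) (_ : ∀ x y, b x y = -b y x),
    Module.finrank ℂ V = d → JKDec a b := by
  induction d using Nat.strong_induction_on with
  | _ d ih =>
    intro V _ _ _ a b ha hb hd
    have ih' : ∀ W : Submodule ℂ V, Module.finrank ℂ W < Module.finrank ℂ V →
        JKDec (a.domRestrict₁₂ W W) (b.domRestrict₁₂ W W) := fun W hW =>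
      ih _ (hd ▸ hW) W _ _ (fun x y => ha x y) (fun x y => hb x y) rfl
    rcases subsingleton_or_nontrivial V with hV | hV
    · exact ⟨Empty, inferInstance, fun i => i.elim, Module.Basis.empty V, fun i => i.elim,
        fun i => i.elim⟩
    by_cases hch : ∃ p f, JKChain a b p f
    · obtain ⟨s, hs⟩ := jk_kronecker_block ha hb hch
      exact JKDec.of_block ha hb hs ih'
    · have : ∃ t : ℂ, Function.Injective (b - t • a) := by
        by_contra! hcon
        apply hch
        apply jk_exists_chain ha hb
        intro t
        have := hcon t
        rw [injective_iff_map_eq_zero] at this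
        push Not at this
        obtain ⟨x, h1, h2⟩ := this
        exact ⟨x, h2, h1⟩
      obtain ⟨t, ht⟩ := this
      exact jk_regular ha hb ht ih'

end decomposition

/-- **Jordan–Kronecker decomposition theorem.** Any two skew-symmetric complex matrices
`A, B` can be simultaneously reduced, by a congruence `X ↦ PᵀXP` with `P` invertible, to a
block-diagonal form (with the same partition of the index set into consecutive blocks for
both matrices, expressed by the order-preserving reindexing equivalence `e`), in which each
pair of corresponding diagonal blocks is a Jordan pair with finite eigenvalue, a Jordan pair
with eigenvalue `∞`, or a Kronecker pair of odd size. -/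
theorem jordan_kronecker_decomposition (n : ℕ) (A B : Matrix (Fin n) (Fin n) ℂ)
    (hA : Aᵀ = -A) (hB : Bᵀ = -B) :
    ∃ (k : ℕ) (spec : Fin k → JKBlockSpec)
      (e : (Σ i : Fin k, Fin ((spec i).size)) ≃ Fin n),
      (∀ p q : Σ i : Fin k, Fin ((spec i).size),
          e p < e q ↔ Sigma.Lex (· < ·) (fun _ => (· < ·)) p q) ∧
      ∃ P : Matrix (Fin n) (Fin n) ℂ, IsUnit P.det ∧
        Pᵀ * A * P = Matrix.reindex e e (Matrix.blockDiagonal' fun i => (spec i).blockA) ∧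
        Pᵀ * B * P = Matrix.reindex e e (Matrix.blockDiagonal' fun i => (spec i).blockB) := by
  classical
  obtain ⟨ι, _, s, β, h1, h2⟩ := jk_main _ (Fin n → ℂ) (Matrix.toLinearMap₂' ℂ A)
    (Matrix.toLinearMap₂' ℂ B)
    (fun x y => by
      rw [Matrix.toLinearMap₂'_apply', Matrix.toLinearMap₂'_apply', dotProduct_comm,
        ← Matrix.vecMul_transpose, hA, ← Matrix.dotProduct_mulVec, Matrix.neg_mulVec,
        dotProduct_neg])
    (fun x y => by
      rw [Matrix.toLinearMap₂'_apply', Matrix.toLinearMap₂'_apply', dotProduct_comm,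
        ← Matrix.vecMul_transpose, hB, ← Matrix.dotProduct_mulVec, Matrix.neg_mulVec,
        dotProduct_neg]) rfl
  let ε : ι ≃ Fin (Fintype.card ι) := Fintype.equivFin ι
  let spec : Fin (Fintype.card ι) → JKBlockSpec := fun i => s (ε.symm i)
  let τ : (Σ i, Fin (spec i).size) ≃ (Σ i, Fin (s i).size) :=
    Equiv.sigmaCongrLeft (β := fun i => Fin (s i).size) ε.symm
  let bas : Module.Basis (Σ i, Fin (spec i).size) ℂ (Fin n → ℂ) := β.reindex τ.symm
  have hbas : ∀ i j, bas ⟨i, j⟩ = β ⟨ε.symm i, j⟩ := by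
    intro i j
    simp only [bas, Module.Basis.reindex_apply, Equiv.symm_symm]
    rfl
  have hcard : Fintype.card (Σₗ i, Fin (spec i).size) = n := by
    have := Module.finrank_eq_card_basis bas
    rw [Module.finrank_fin_fun] at this
    exact this.symm
  let o := Fintype.orderIsoFinOfCardEq (Σₗ i, Fin (spec i).size) hcard
  let e : (Σ i, Fin (spec i).size) ≃ Fin n := toLex.trans o.symm.toEquiv
  refine ⟨Fintype.card ι, spec, e, ?_, ?_⟩
  · intro p q
    exact o.symm.lt_iff_lt (x := toLex p) (y := toLex q)
  let P : Matrix (Fin n) (Fin n) ℂ := (Pi.basisFun ℂ (Fin n)).toMatrix (bas.reindex e)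
  have hP : ∀ i p, P i p = bas (e.symm p) i := by
    intro i p
    simp [P, Module.Basis.toMatrix_apply]
  have hM : ∀ (M : Matrix (Fin n) (Fin n) ℂ) p q, (Pᵀ * M * P) p q
      = Matrix.toLinearMap₂' ℂ M (bas (e.symm p)) (bas (e.symm q)) := by
    intro M p q
    rw [Matrix.toLinearMap₂'_apply', Matrix.dotProduct_mulVec]
    simp only [Matrix.mul_apply, Matrix.vecMul, dotProduct, Matrix.transpose_apply, hP]
  refine ⟨P, ?_, ?_, ?_⟩
  · have : Invertible P := (Pi.basisFun ℂ (Fin n)).invertibleToMatrix (bas.reindex e)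
    exact Matrix.isUnit_det_of_invertible P
  · ext p q
    rw [hM, Matrix.reindex_apply, Matrix.submatrix_apply]
    rcases e.symm p with ⟨i, j⟩
    rcases e.symm q with ⟨i', j'⟩
    rw [hbas, hbas]
    by_cases hii : i = i'
    · subst hii
      rw [Matrix.blockDiagonal'_apply_eq]
      exact (h1 _ _ _).1
    · rw [Matrix.blockDiagonal'_apply_ne _ _ _ hii]
      exact (h2 _ _ _ _ (fun h => hii (ε.symm.injective h))).1
  · ext p q
    rw [hM, Matrix.reindex_apply, Matrix.submatrix_apply]
    rcases e.symm p with ⟨i, j⟩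
    rcases e.symm q with ⟨i', j'⟩
    rw [hbas, hbas]
    by_cases hii : i = i'
    · subst hii
      rw [Matrix.blockDiagonal'_apply_eq]
      exact (h1 _ _ _).2
    · rw [Matrix.blockDiagonal'_apply_ne _ _ _ hii]
      exact (h2 _ _ _ _ (fun h => hii (ε.symm.injective h))).2
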